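/- Let E be a real Banach space, {S(t)}_{t≥0} a contraction C₀-semigroup on E, a < b, and f : [a,b] × E → E continuous. Let K ⊂ E be nonempty, open and bounded, and let V : E → ℝ be locally Lipschitz with V(x) = 0 for all x ∈ ∂K, V(x) ≤ 0 for all x ∈ K, and liminf_{h→0⁻} V(x + h·f(t,x))/h < 0 for all t ∈ (a,b] and all x ∈ ∂K. Assume there exists δ > 0 such that S(τ)(K̄) ⊆ K̄ for all τ ∈ [0,δ]. If x : [a,b] → E is a mild solution of x′ = Ax + f(t,x) (i.e. x is continuous and x(t) = S(t−a)x(a) + ∫ₐᵗ S(t−s) f(s,x(s)) ds for all t ∈ [a,b]) with x(t) ∈ K̄ for all t ∈ [a,b], then x(t) ∈ K for every t ∈ (a,b]. -/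

import Mathlib

open MeasureTheory Filter Topology Set

/-- A strongly continuous contraction semigroup is jointly continuous in time and space. -/
theorem continuousOn_uncurry_of_norm_le_one
    {E : Type*} [NormedAddCommGroup E] [NormedSpace ℝ E] (S : ℝ → E →L[ℝ] E)
    (hScont : ∀ v : E, ContinuousOn (fun t => S t v) (Set.Ici (0:ℝ)))
    (hScontr : ∀ t : ℝ, 0 ≤ t → ‖S t‖ ≤ 1) :
    ContinuousOn (fun q : ℝ × E => S q.1 q.2) (Set.Ici (0:ℝ) ×ˢ (Set.univ : Set E)) := by
  rintro ⟨τ, v⟩ ⟨hτ, -⟩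
  have hτv : Tendsto (fun q : ℝ × E => S q.1 v) (𝓝[Set.Ici (0:ℝ) ×ˢ Set.univ] (τ, v))
      (𝓝 (S τ v)) :=
    (hScont v τ hτ).tendsto.comp
      ((continuous_fst.continuousWithinAt.tendsto_nhdsWithin fun q hq => hq.1 :
        Tendsto Prod.fst (𝓝[Set.Ici (0:ℝ) ×ˢ (Set.univ : Set E)] (τ, v)) (𝓝[Set.Ici 0] τ)))
  have hdiff : Tendsto (fun q : ℝ × E => S q.1 (q.2 - v))
      (𝓝[Set.Ici (0:ℝ) ×ˢ Set.univ] (τ, v)) (𝓝 0) := by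
    have hlim : Tendsto (fun q : ℝ × E => ‖q.2 - v‖)
        (𝓝[Set.Ici (0:ℝ) ×ˢ Set.univ] (τ, v)) (𝓝 0) := by
      have hc : Continuous fun q : ℝ × E => ‖q.2 - v‖ := by fun_prop
      simpa using (hc.tendsto (τ, v)).mono_left nhdsWithin_le_nhds
    refine squeeze_zero_norm' ?_ hlim
    filter_upwards [self_mem_nhdsWithin] with q hq
    simpa using (S q.1).le_of_opNorm_le (hScontr q.1 hq.1) (q.2 - v)
  have hsum := hdiff.add hτv
  simpa [ContinuousWithinAt] using hsum

/-- Restarting the variation of constants formula at an intermediate time `r`. -/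
theorem mild_solution_restart
    {E : Type*} [NormedAddCommGroup E] [NormedSpace ℝ E] [CompleteSpace E]
    (S : ℝ → E →L[ℝ] E)
    (hSadd : ∀ t s : ℝ, 0 ≤ t → 0 ≤ s → S (t + s) = (S t).comp (S s))
    {a r t : ℝ} (har : a ≤ r) (hrt : r ≤ t) {g x : ℝ → E}
    (hr : ContinuousOn (fun s => S (r - s) (g s)) (Set.Icc a r))
    (ht : ContinuousOn (fun s => S (t - s) (g s)) (Set.Icc a t))
    (hxr : x r = S (r - a) (x a) + ∫ s in a..r, S (r - s) (g s))
    (hxt : x t = S (t - a) (x a) + ∫ s in a..t, S (t - s) (g s)) :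
    x t = S (t - r) (x r) + ∫ s in r..t, S (t - s) (g s) := by
  have hint : ∫ s in a..r, S (t - s) (g s) = S (t - r) (∫ s in a..r, S (r - s) (g s)) := by
    rw [← ContinuousLinearMap.intervalIntegral_comp_comm _
      (hr.intervalIntegrable_of_Icc har)]
    refine intervalIntegral.integral_congr fun s hs => ?_
    rw [Set.uIcc_of_le har] at hs
    have h := hSadd (t - r) (r - s) (by linarith) (by linarith [hs.2])
    rw [sub_add_sub_cancel] at h
    simp [h]
  have hsplit := intervalIntegral.integral_add_adjacent_intervals
    ((ht.mono (Set.Icc_subset_Icc_right hrt)).intervalIntegrable_of_Icc har)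
    ((ht.mono (Set.Icc_subset_Icc_left har)).intervalIntegrable_of_Icc (μ := volume) hrt)
  have h := hSadd (t - r) (r - a) (by linarith) (by linarith)
  rw [sub_add_sub_cancel] at h
  rw [hxt, hxr, ← hsplit, hint, h, map_add, ContinuousLinearMap.comp_apply, add_assoc]

/-- If `V (p + h • v)` is eventually at most `ε * |h|` as `h → 0⁻`, for every `ε > 0`, then the lower
left Dini derivative at a zero `p` of `V` is nonnegative. -/
theorem liminf_div_nonneg_of_eventually_le
    {E : Type*} [NormedAddCommGroup E] [NormedSpace ℝ E] {V : E → ℝ} (hV : LocallyLipschitz V)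
    {p v : E} (hp : V p = 0)
    (h : ∀ ε > 0, ∀ᶠ h in 𝓝[<] (0:ℝ), V (p + h • v) ≤ ε * (-h)) :
    0 ≤ liminf (fun h : ℝ => V (p + h • v) / h) (𝓝[<] (0:ℝ)) := by
  obtain ⟨L, U, hU, hL⟩ := hV p
  have hlim : Tendsto (fun h : ℝ => p + h • v) (𝓝[<] (0:ℝ)) (𝓝 p) := by
    have hc : Continuous fun h : ℝ => p + h • v := by fun_prop
    simpa using (hc.tendsto 0).mono_left nhdsWithin_le_nhds
  have hbdd : IsBoundedUnder (· ≤ ·) (𝓝[<] (0:ℝ)) fun h : ℝ => V (p + h • v) / h := by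
    refine isBoundedUnder_of_eventually_le (a := L * ‖v‖) ?_
    filter_upwards [hlim hU, self_mem_nhdsWithin] with h hh (hneg : h < 0)
    have hd := hL.dist_le_mul _ hh _ (mem_of_mem_nhds hU)
    rw [hp, Real.dist_eq, sub_zero, dist_eq_norm, add_sub_cancel_left, norm_smul,
      Real.norm_eq_abs, abs_of_neg hneg] at hd
    rw [div_le_iff_of_neg hneg]
    linarith [neg_abs_le (V (p + h • v))]
  refine le_of_forall_pos_le_add fun ε hε => ?_
  rw [← neg_le_iff_add_nonneg]
  refine le_liminf_of_le hbdd.isCoboundedUnder_ge ?_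
  filter_upwards [h ε hε, self_mem_nhdsWithin] with h hh (hneg : h < 0)
  rw [le_div_iff_of_neg hneg]
  linarith

/-- A mild solution lying in the closure of `K` actually lies in `K`
on `(a,b]`, in the presence of a locally Lipschitz bounding function. -/
theorem mild_solution_stays_in_K
    {E : Type*} [NormedAddCommGroup E] [NormedSpace ℝ E] [CompleteSpace E]
    (S : ℝ → E →L[ℝ] E)
    (hS0 : S 0 = ContinuousLinearMap.id ℝ E)
    (hSadd : ∀ t s : ℝ, 0 ≤ t → 0 ≤ s → S (t + s) = (S t).comp (S s))
    (hScont : ∀ v : E, ContinuousOn (fun t => S t v) (Set.Ici (0:ℝ)))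
    (hScontr : ∀ t : ℝ, 0 ≤ t → ‖S t‖ ≤ 1)
    (a b : ℝ) (hab : a < b)
    (f : ℝ → E → E)
    (hf : ContinuousOn (fun q : ℝ × E => f q.1 q.2) (Set.Icc a b ×ˢ (Set.univ : Set E)))
    (K : Set E) (hKne : K.Nonempty) (hKopen : IsOpen K) (hKbd : Bornology.IsBounded K)
    (V : E → ℝ) (hVlip : LocallyLipschitz V)
    (hV0 : ∀ x ∈ frontier K, V x = 0)
    (hVle : ∀ x ∈ K, V x ≤ 0)
    (hVb : ∀ t ∈ Set.Ioc a b, ∀ x ∈ frontier K,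
      liminf (fun h : ℝ => V (x + h • f t x) / h) (nhdsWithin 0 (Set.Iio 0)) < 0)
    (δ : ℝ) (hδ : 0 < δ)
    (hSK : ∀ τ ∈ Set.Icc (0:ℝ) δ, (S τ) '' closure K ⊆ closure K)
    (x : ℝ → E) (hx : ContinuousOn x (Set.Icc a b))
    (hmild : ∀ t ∈ Set.Icc a b,
      x t = S (t - a) (x a) + ∫ s in a..t, S (t - s) (f s (x s)))
    (hxK : ∀ t ∈ Set.Icc a b, x t ∈ closure K) :
    ∀ t ∈ Set.Ioc a b, x t ∈ K := by
  intro t ht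
  by_contra htK
  have htab : t ∈ Set.Icc a b := ⟨ht.1.le, ht.2⟩
  have hfr : x t ∈ frontier K := by
    rw [hKopen.frontier_eq]
    exact ⟨hxK t htab, htK⟩
  have hVcl : ∀ y ∈ closure K, V y ≤ 0 := fun y hy =>
    closure_minimal hVle (isClosed_le hVlip.continuous continuous_const) hy
  have hg : ContinuousOn (fun s => f s (x s)) (Set.Icc a b) :=
    hf.comp (continuousOn_id.prodMk hx) fun s hs => ⟨hs, Set.mem_univ _⟩
  have hF : ∀ r ≤ b, ContinuousOn (fun s => S (r - s) (f s (x s))) (Set.Icc a r) := fun r hr =>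
    (continuousOn_uncurry_of_norm_le_one S hScont hScontr).comp
      ((continuousOn_const.sub continuousOn_id).prodMk (hg.mono (Set.Icc_subset_Icc_right hr)))
      fun s hs => ⟨sub_nonneg.2 hs.2, Set.mem_univ _⟩
  refine (hVb t ht _ hfr).not_ge
    (liminf_div_nonneg_of_eventually_le hVlip (hV0 _ hfr) fun ε hε => ?_)
  obtain ⟨L, U, hU, hL⟩ := hVlip (x t)
  have hLpos : (0:ℝ) < L + 1 := by positivity
  set η : ℝ := ε / (L + 1) with hη
  have hηpos : 0 < η := by positivity
  have hLη : L * η ≤ ε := by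
    have : (L + 1) * η = ε := by rw [hη]; field_simp
    linarith
  obtain ⟨ρ, hρ, hFρ⟩ := Metric.continuousOn_iff.1 (hF t ht.2) t ⟨ht.1.le, le_rfl⟩ η hηpos
  simp only [sub_self, hS0, ContinuousLinearMap.id_apply] at hFρ
  set v := f t (x t)
  -- the point `S (-h) (x (t + h))` of `closure K` is `o(h)`-close to `x t + h • v`
  have hclose : ∀ᶠ h in 𝓝[<] (0:ℝ), S (-h) (x (t + h)) ∈ closure K ∧
      ‖x t + h • v - S (-h) (x (t + h))‖ ≤ η * (-h) := by
    have hsmall : ∀ c > 0, ∀ᶠ h in 𝓝[<] (0:ℝ), -c < h := fun c hc =>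
      nhdsWithin_le_nhds (lt_mem_nhds (neg_lt_zero.2 hc))
    filter_upwards [hsmall δ hδ, hsmall ρ hρ, hsmall (t - a) (sub_pos.2 ht.1),
      self_mem_nhdsWithin] with h h1 h2 h3 (hneg : h < 0)
    have hmem : t + h ∈ Set.Icc a b := ⟨by linarith, by linarith [ht.2]⟩
    refine ⟨hSK (-h) ⟨by linarith, by linarith⟩ (Set.mem_image_of_mem _ (hxK _ hmem)), ?_⟩
    have hrestart := mild_solution_restart S hSadd hmem.1 (by linarith : t + h ≤ t)
      (hF _ hmem.2) (hF t ht.2) (hmild _ hmem) (hmild t htab)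
    rw [sub_add_cancel_left] at hrestart
    have hintg : IntervalIntegrable (fun s => S (t - s) (f s (x s))) volume (t + h) t :=
      ((hF t ht.2).mono (Set.Icc_subset_Icc_left hmem.1)).intervalIntegrable_of_Icc
        (by linarith)
    have heq : x t + h • v - S (-h) (x (t + h)) =
        ∫ s in (t + h)..t, (S (t - s) (f s (x s)) - v) := by
      rw [intervalIntegral.integral_sub hintg intervalIntegrable_const,
        intervalIntegral.integral_const, sub_add_cancel_left, neg_smul, sub_neg_eq_add,
        sub_eq_iff_eq_add, add_right_comm, add_comm (intervalIntegral _ _ _ _), ← hrestart]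
    rw [heq]
    refine (intervalIntegral.norm_integral_le_of_norm_le_const (C := η) fun s hs => ?_).trans ?_
    · rw [Set.uIoc_of_le (by linarith)] at hs
      rw [← dist_eq_norm]
      refine (hFρ s ⟨by linarith [hs.1], hs.2⟩ ?_).le
      rw [Real.dist_eq, abs_lt]
      constructor <;> linarith [hs.1, hs.2]
    · rw [sub_add_cancel_left, abs_of_pos (by linarith)]
  have hlim : Tendsto (fun h : ℝ => x t + h • v) (𝓝[<] (0:ℝ)) (𝓝 (x t)) := by
    have hc : Continuous fun h : ℝ => x t + h • v := by fun_prop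
    simpa using (hc.tendsto 0).mono_left nhdsWithin_le_nhds
  have hdiff : Tendsto (fun h : ℝ => x t + h • v - S (-h) (x (t + h))) (𝓝[<] (0:ℝ)) (𝓝 0) := by
    have hc : Continuous fun h : ℝ => η * (-h) := by fun_prop
    refine squeeze_zero_norm' (hclose.mono fun h hh => hh.2) ?_
    simpa using (hc.tendsto 0).mono_left nhdsWithin_le_nhds
  have hlim' : Tendsto (fun h : ℝ => S (-h) (x (t + h))) (𝓝[<] (0:ℝ)) (𝓝 (x t)) := by
    simpa using hlim.sub hdiff
  filter_upwards [hclose, hlim hU, hlim' hU, self_mem_nhdsWithin] with h hh hm hm' (hneg : h < 0)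
  have hd := hL.dist_le_mul _ hm _ hm'
  rw [Real.dist_eq, dist_eq_norm] at hd
  calc V (x t + h • v) ≤ V (S (-h) (x (t + h))) + L * (η * (-h)) := by
        linarith [le_abs_self (V (x t + h • v) - V (S (-h) (x (t + h)))),
          mul_le_mul_of_nonneg_left hh.2 L.coe_nonneg]
    _ ≤ 0 + ε * (-h) := by
        rw [← mul_assoc]
        exact add_le_add (hVcl _ hh.1) (mul_le_mul_of_nonneg_right hLη (by linarith))
    _ = ε * (-h) := zero_add _
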